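/- arXiv:2102.09856 — 8 statements merged into one kernel-verified Lean document; each statement's English description precedes it below -/
import Mathlib

section
/- Let G = (V,E) be a finite simple graph and let {u,v} ∈ E be an edge. Let D be the event that D_{u∧v} > D_{u\v} and D_{u∧v} > D_{v\u}. Then the probability that the edge {u,v} is monochrome after the Flip-Schelling-Process is at least 1/2 + P(D)/2. -/
open Finset

/-- The signed sum `Σ_{w ∈ s} σ(w)` of the ±1 types (encoded as `Bool`, `true ↦ +1`,
`false ↦ -1`) over a finite set of vertices. -/
def typeSum {V : Type} [DecidableEq V] (σ : V → Bool) (s : Finset V) : ℤ :=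
  ∑ w ∈ s, (if σ w then 1 else -1)

/-- The new type of vertex `v` after one round of the Flip-Schelling-Process, given the
initial types `σ` and the tie-breaking coins `coin`. -/
def newType {V : Type} [Fintype V] [DecidableEq V] (G : SimpleGraph V) [DecidableRel G.Adj]
    (σ coin : V → Bool) (v : V) : Bool :=
  if 0 < typeSum σ (G.neighborFinset v) then true
  else if typeSum σ (G.neighborFinset v) < 0 then false
  else coin v

/-- The probability of an event `E` over the uniformly random choice of the initial types
and the (independent) tie-breaking coins. -/
noncomputable def fspPr {V : Type} [Fintype V] [DecidableEq V]
    (E : (V → Bool) × (V → Bool) → Prop) [DecidablePred E] : ℝ :=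
  ((Finset.univ.filter E).card : ℝ) / (Fintype.card ((V → Bool) × (V → Bool)) : ℝ)

/-- Flip the types on a finite set. -/
def flipOn {V : Type} [DecidableEq V] (S : Finset V) (σ : V → Bool) : V → Bool :=
  fun w => if w ∈ S then !(σ w) else σ w

lemma flipOn_flipOn {V : Type} [DecidableEq V] (S : Finset V) (σ : V → Bool) :
    flipOn S (flipOn S σ) = σ := by
  funext w
  by_cases h : w ∈ S <;> simp [flipOn, h]

lemma typeSum_flipOn_self {V : Type} [DecidableEq V] (S : Finset V) (σ : V → Bool) :
    typeSum (flipOn S σ) S = - typeSum σ S := by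
  unfold typeSum
  rw [← Finset.sum_neg_distrib]
  refine Finset.sum_congr rfl fun w hw => ?_
  cases h : σ w <;> simp [flipOn, hw, h]

lemma typeSum_flipOn_disj {V : Type} [DecidableEq V] (S T : Finset V) (σ : V → Bool)
    (hd : Disjoint T S) : typeSum (flipOn S σ) T = typeSum σ T := by
  unfold typeSum
  refine Finset.sum_congr rfl fun w hw => ?_
  have : w ∉ S := Finset.disjoint_left.mp hd hw
  simp [flipOn, this]

lemma typeSum_split {V : Type} [DecidableEq V] (S T : Finset V) (σ : V → Bool) :
    typeSum σ S = typeSum σ (S \ T) + typeSum σ (S ∩ T) := by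
  unfold typeSum
  rw [add_comm, Finset.sum_inter_add_sum_sdiff]

lemma fsp_count {V : Type} [Fintype V] [DecidableEq V]
    (D M : (V → Bool) × (V → Bool) → Prop) [DecidablePred D] [DecidablePred M]
    (f : (V → Bool) × (V → Bool) → (V → Bool) × (V → Bool)) (hf : ∀ ω, f (f ω) = ω)
    (hDM : ∀ ω, D ω → M ω) (h : ∀ ω, ¬ M ω → M (f ω) ∧ ¬ D (f ω)) :
    1 / 2 + fspPr D / 2 ≤ fspPr M := by
  have h1 : (univ.filter fun ω => ¬ M ω).card ≤ (univ.filter fun ω => M ω ∧ ¬ D ω).card := by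
    refine Finset.card_le_card_of_injOn f ?_ ?_
    · intro ω hω
      simp only [Finset.coe_filter, Finset.mem_univ, true_and, Set.mem_ofPred_eq] at hω ⊢
      exact h ω hω
    · exact (Function.LeftInverse.injective hf).injOn
  have h2 := Finset.card_filter_add_card_filter_not
    (s := (univ : Finset ((V → Bool) × (V → Bool)))) M
  have h3 := Finset.card_filter_add_card_filter_not (s := univ.filter M) D
  rw [Finset.filter_filter, Finset.filter_filter] at h3
  have h4 : (univ.filter fun ω => M ω ∧ D ω) = univ.filter D := by
    ext ω
    simp only [Finset.mem_filter, Finset.mem_univ, true_and]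
    exact ⟨fun x => x.2, fun x => ⟨hDM ω x, x⟩⟩
  rw [h4] at h3
  rw [Finset.card_univ] at h2
  have key : Fintype.card ((V → Bool) × (V → Bool)) + (univ.filter D).card
      ≤ 2 * (univ.filter M).card := by omega
  have key' : (Fintype.card ((V → Bool) × (V → Bool)) : ℝ) + ((univ.filter D).card : ℝ)
      ≤ 2 * ((univ.filter M).card : ℝ) := by exact_mod_cast key
  have hpos : (0 : ℝ) < (Fintype.card ((V → Bool) × (V → Bool)) : ℝ) := by
    exact_mod_cast Fintype.card_pos
  unfold fspPr
  rw [div_add_div _ _ (by norm_num) (by norm_num), div_le_iff₀ (by norm_num),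
    ← sub_nonneg]
  have e : ((univ.filter M).card : ℝ) / (Fintype.card ((V → Bool) × (V → Bool)) : ℝ) * (2 * 2)
      - (1 * 2 + 2 * (((univ.filter D).card : ℝ) /
        (Fintype.card ((V → Bool) × (V → Bool)) : ℝ)))
      = 2 * (2 * ((univ.filter M).card : ℝ) - (Fintype.card ((V → Bool) × (V → Bool)) : ℝ)
        - ((univ.filter D).card : ℝ)) / (Fintype.card ((V → Bool) × (V → Bool)) : ℝ) := by
    field_simp
    ring
  rw [e]
  apply div_nonneg _ hpos.le
  linarith

/-- The sign of `s` with tie-breaking coin `k`. -/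
def sgnTie (s : ℤ) (k : Bool) : Bool :=
  if 0 < s then true else if s < 0 then false else k

/-- The pairing of monochrome and non-monochrome configurations; `A`, `B` are the exclusive
neighborhoods and `C` the common one. -/
def pairing {V : Type} [DecidableEq V] (A B C : Finset V) (u v : V)
    (ω : (V → Bool) × (V → Bool)) : (V → Bool) × (V → Bool) :=
  if |typeSum ω.1 C| < |typeSum ω.1 A| ∨ typeSum ω.1 C = 0 then
    (flipOn A ω.1, flipOn {u} ω.2)
  else if |typeSum ω.1 C| < |typeSum ω.1 B| then (flipOn B ω.1, flipOn {v} ω.2)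
  else if typeSum ω.1 A = - typeSum ω.1 C then (ω.1, flipOn {u} ω.2)
  else (ω.1, flipOn {v} ω.2)

lemma pairing_pairing {V : Type} [DecidableEq V] (A B C : Finset V) (u v : V)
    (hAB : Disjoint A B) (hCA : Disjoint C A) (hCB : Disjoint C B)
    (ω : (V → Bool) × (V → Bool)) : pairing A B C u v (pairing A B C u v ω) = ω := by
  obtain ⟨σ, κ⟩ := ω
  by_cases h1 : |typeSum σ C| < |typeSum σ A| ∨ typeSum σ C = 0
  · simp [pairing, h1, typeSum_flipOn_self, typeSum_flipOn_disj _ _ _ hCA, flipOn_flipOn]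
  · by_cases h2 : |typeSum σ C| < |typeSum σ B|
    · simp [pairing, h1, h2, typeSum_flipOn_self, typeSum_flipOn_disj _ _ _ hCB,
        typeSum_flipOn_disj _ _ _ hAB, flipOn_flipOn]
    · by_cases h3 : typeSum σ A = - typeSum σ C
      · have e : ∀ κ' : V → Bool, pairing A B C u v (σ, κ') = (σ, flipOn {u} κ') := by
          intro κ'
          rw [pairing, if_neg h1, if_neg h2, if_pos h3]
        rw [e, e, flipOn_flipOn]
      · simp [pairing, h1, h2, h3, flipOn_flipOn]

lemma dec_mono (a b c : ℤ) (k l : Bool) (h : |c| > |a| ∧ |c| > |b|) :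
    sgnTie (a + c) k = sgnTie (b + c) l := by
  obtain ⟨h1, h2⟩ := h
  unfold sgnTie
  grind

lemma case_flip (a b c : ℤ) (k l : Bool) (h1 : |c| < |a| ∨ c = 0)
    (h : ¬ sgnTie (a + c) k = sgnTie (b + c) l) :
    sgnTie (-a + c) (!k) = sgnTie (b + c) l := by
  have : sgnTie (-a + c) (!k) = ! sgnTie (a + c) k := by
    unfold sgnTie
    grind
  rw [this]
  revert h
  cases sgnTie (a + c) k <;> cases sgnTie (b + c) l <;> simp

lemma case_left (a b c : ℤ) (k l : Bool) (h1 : ¬ (|c| < |a| ∨ c = 0)) (h2 : ¬ |c| < |b|)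
    (h3 : a = -c) (h : ¬ sgnTie (a + c) k = sgnTie (b + c) l) :
    sgnTie (a + c) (!k) = sgnTie (b + c) l := by
  subst h3
  simp only [sgnTie, neg_add_cancel, lt_irrefl, if_false] at h ⊢
  revert h
  cases k <;> grind

lemma case_right (a b c : ℤ) (k l : Bool) (h1 : ¬ (|c| < |a| ∨ c = 0)) (h2 : ¬ |c| < |b|)
    (h3 : ¬ a = -c) (h : ¬ sgnTie (a + c) k = sgnTie (b + c) l) :
    sgnTie (a + c) k = sgnTie (b + c) (!l) := by
  unfold sgnTie at h ⊢
  cases k <;> cases l <;> grind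

/-- For an edge `{u,v}` of a finite simple graph, the probability that
`{u,v}` is monochrome after the Flip-Schelling-Process is at least `1/2 + P(D)/2`, where
`D` is the event that the decisiveness of the common neighborhood of `u` and `v` exceeds
the decisiveness of each of the two exclusive neighborhoods. -/
theorem fsp_monochrome_lower_bound {V : Type} [Fintype V] [DecidableEq V]
    (G : SimpleGraph V) [DecidableRel G.Adj] (u v : V) (huv : G.Adj u v) :
    1 / 2 + (fspPr (fun ω : (V → Bool) × (V → Bool) =>
        |typeSum ω.1 (G.neighborFinset u ∩ G.neighborFinset v)| >
          |typeSum ω.1 (G.neighborFinset u \ G.neighborFinset v)| ∧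
        |typeSum ω.1 (G.neighborFinset u ∩ G.neighborFinset v)| >
          |typeSum ω.1 (G.neighborFinset v \ G.neighborFinset u)|)) / 2 ≤
      fspPr (fun ω : (V → Bool) × (V → Bool) =>
        newType G ω.1 ω.2 u = newType G ω.1 ω.2 v) := by
  have hne : u ≠ v := huv.ne
  set A := G.neighborFinset u \ G.neighborFinset v with hA
  set B := G.neighborFinset v \ G.neighborFinset u with hB
  set C := G.neighborFinset u ∩ G.neighborFinset v with hC
  have hAB : Disjoint A B := by
    rw [Finset.disjoint_left]; intro w; simp only [hA, hB, Finset.mem_sdiff]; tauto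
  have hCA : Disjoint C A := by
    rw [Finset.disjoint_left]; intro w
    simp only [hA, hC, Finset.mem_sdiff, Finset.mem_inter]; tauto
  have hCB : Disjoint C B := by
    rw [Finset.disjoint_left]; intro w
    simp only [hB, hC, Finset.mem_sdiff, Finset.mem_inter]; tauto
  have nu : ∀ σ κ, newType G σ κ u = sgnTie (typeSum σ A + typeSum σ C) (κ u) := by
    intro σ κ
    rw [hA, hC, ← typeSum_split]; rfl
  have nv : ∀ σ κ, newType G σ κ v = sgnTie (typeSum σ B + typeSum σ C) (κ v) := by
    intro σ κ
    rw [hB, hC, Finset.inter_comm, ← typeSum_split]; rfl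
  have fu : ∀ κ : V → Bool, flipOn {u} κ u = !(κ u) := fun κ => by simp [flipOn]
  have fv : ∀ κ : V → Bool, flipOn {v} κ v = !(κ v) := fun κ => by simp [flipOn]
  have fuv : ∀ κ : V → Bool, flipOn {u} κ v = κ v := fun κ => by simp [flipOn, hne.symm]
  have fvu : ∀ κ : V → Bool, flipOn {v} κ u = κ u := fun κ => by simp [flipOn, hne]
  refine fsp_count _ _ (pairing A B C u v) (pairing_pairing A B C u v hAB hCA hCB) ?_ ?_
  · rintro ⟨σ, κ⟩ h
    simp only [nu, nv]
    exact dec_mono _ _ _ _ _ h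
  · rintro ⟨σ, κ⟩ h
    have hD : ¬ (|typeSum σ C| > |typeSum σ A| ∧ |typeSum σ C| > |typeSum σ B|) := by
      intro hd
      apply h
      simp only [nu, nv]
      exact dec_mono _ _ _ _ _ hd
    simp only [nu, nv] at h ⊢
    by_cases h1 : |typeSum σ C| < |typeSum σ A| ∨ typeSum σ C = 0
    · simp only [pairing, h1, if_true, typeSum_flipOn_self, typeSum_flipOn_disj _ _ _ hCA,
        typeSum_flipOn_disj _ _ _ hAB.symm, fu, fuv, abs_neg]
      exact ⟨case_flip _ _ _ _ _ h1 h, hD⟩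
    · by_cases h2 : |typeSum σ C| < |typeSum σ B|
      · simp only [pairing, h1, h2, if_true, if_false, typeSum_flipOn_self,
          typeSum_flipOn_disj _ _ _ hCB, typeSum_flipOn_disj _ _ _ hAB, fv, fvu, abs_neg]
        exact ⟨(case_flip _ _ _ _ _ (Or.inl h2) (fun e => h e.symm)).symm, hD⟩
      · by_cases h3 : typeSum σ A = - typeSum σ C
        · rw [pairing, if_neg h1, if_neg h2, if_pos h3]
          simp only [fu, fuv]
          exact ⟨case_left _ _ _ _ _ h1 h2 h3 h, hD⟩
        · rw [pairing, if_neg h1, if_neg h2, if_neg h3]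
          simp only [fv, fvu]
          exact ⟨case_right _ _ _ _ _ h1 h2 h3 h, hD⟩
end

section
/- Let G = (V,E) be a finite simple graph and let {u,v} ∈ E be an edge such that N(u) ∩ N(v) = ∅. Then the probability that the edge {u,v} is monochrome after the Flip-Schelling-Process is exactly 1/2. -/
open Finset

/-- Flip the initial types on the neighborhood of `u` and the coin of `u`. -/
def fspFlip {V : Type} [Fintype V] [DecidableEq V] (G : SimpleGraph V) [DecidableRel G.Adj]
    (u : V) (ω : (V → Bool) × (V → Bool)) : (V → Bool) × (V → Bool) :=
  (fun w => if w ∈ G.neighborFinset u then !(ω.1 w) else ω.1 w,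
   fun w => if w = u then !(ω.2 w) else ω.2 w)

theorem fspFlip_fspFlip {V : Type} [Fintype V] [DecidableEq V] (G : SimpleGraph V)
    [DecidableRel G.Adj] (u : V) (ω : (V → Bool) × (V → Bool)) :
    fspFlip G u (fspFlip G u ω) = ω := by
  unfold fspFlip
  ext w
  · by_cases h : w ∈ G.neighborFinset u <;> simp only [h, if_true, if_false, Bool.not_not]
  · by_cases h : w = u <;> simp only [h, if_true, if_false, Bool.not_not]

theorem newType_fspFlip_self {V : Type} [Fintype V] [DecidableEq V] (G : SimpleGraph V)
    [DecidableRel G.Adj] (u : V) (ω : (V → Bool) × (V → Bool)) :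
    newType G (fspFlip G u ω).1 (fspFlip G u ω).2 u = !(newType G ω.1 ω.2 u) := by
  have h : typeSum (fspFlip G u ω).1 (G.neighborFinset u)
      = - typeSum ω.1 (G.neighborFinset u) := by
    unfold typeSum fspFlip
    rw [← Finset.sum_neg_distrib]
    apply Finset.sum_congr rfl
    intro w hw
    simp only [hw, if_true]
    cases ω.1 w <;> simp
  have hc : (fspFlip G u ω).2 u = !(ω.2 u) := by simp [fspFlip]
  unfold newType
  rw [h, hc]
  rcases lt_trichotomy (typeSum ω.1 (G.neighborFinset u)) 0 with h1 | h1 | h1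
  · simp [h1, not_lt.mpr h1.le]
  · simp [h1]
  · simp [h1, not_lt.mpr h1.le]

theorem newType_fspFlip_other {V : Type} [Fintype V] [DecidableEq V] (G : SimpleGraph V)
    [DecidableRel G.Adj] (u v : V) (huv : G.Adj u v)
    (hcommon : G.neighborFinset u ∩ G.neighborFinset v = ∅) (ω : (V → Bool) × (V → Bool)) :
    newType G (fspFlip G u ω).1 (fspFlip G u ω).2 v = newType G ω.1 ω.2 v := by
  have h : typeSum (fspFlip G u ω).1 (G.neighborFinset v)
      = typeSum ω.1 (G.neighborFinset v) := by
    unfold typeSum fspFlip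
    apply Finset.sum_congr rfl
    intro w hw
    have : w ∉ G.neighborFinset u := fun hu => by
      have hm := Finset.mem_inter.mpr ⟨hu, hw⟩
      rw [hcommon] at hm
      exact Finset.notMem_empty _ hm
    simp only [this, if_false]
  have hc : (fspFlip G u ω).2 v = ω.2 v := by simp [fspFlip, huv.ne']
  unfold newType
  rw [h, hc]

/-- For an edge `{u,v}` of a finite simple graph whose endpoints have no
common neighbor, the probability that `{u,v}` is monochrome after the
Flip-Schelling-Process is exactly `1/2`. -/
theorem fsp_monochrome_of_empty_common_neighborhood {V : Type} [Fintype V] [DecidableEq V]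
    (G : SimpleGraph V) [DecidableRel G.Adj] (u v : V) (huv : G.Adj u v)
    (hcommon : G.neighborFinset u ∩ G.neighborFinset v = ∅) :
    fspPr (fun ω : (V → Bool) × (V → Bool) =>
        newType G ω.1 ω.2 u = newType G ω.1 ω.2 v) = 1 / 2 := by
  unfold fspPr
  set E : (V → Bool) × (V → Bool) → Prop := fun ω =>
    newType G ω.1 ω.2 u = newType G ω.1 ω.2 v with hE
  have hflip : ∀ ω, E (fspFlip G u ω) ↔ ¬ E ω := by
    intro ω
    simp only [hE, newType_fspFlip_self, newType_fspFlip_other G u v huv hcommon]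
    cases newType G ω.1 ω.2 u <;> cases newType G ω.1 ω.2 v <;> simp
  have heq : (Finset.univ.filter E).card = (Finset.univ.filter (fun ω => ¬ E ω)).card := by
    apply Finset.card_nbij' (fspFlip G u) (fspFlip G u)
    · intro ω hω
      simpa [hflip] using hω
    · intro ω hω
      simpa [hflip] using hω
    · intro ω _
      exact fspFlip_fspFlip G u ω
    · intro ω _
      exact fspFlip_fspFlip G u ω
  have hsum := Finset.card_filter_add_card_filter_not
    (s := (Finset.univ : Finset ((V → Bool) × (V → Bool)))) E
  rw [← heq, Finset.card_univ] at hsum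
  have hpos : 0 < Fintype.card ((V → Bool) × (V → Bool)) := Fintype.card_pos
  rw [← hsum] at hpos ⊢
  have hp : (0 : ℝ) < ((Finset.univ.filter E).card : ℝ) := by
    exact_mod_cast (by omega : 0 < (Finset.univ.filter E).card)
  push_cast
  field_simp
  norm_num
  rfl
end

section
/- Let n ∈ ℕ and let p, q ∈ [0,1] with p ≥ q. Let X ~ Bin(n,p) and Y ~ Bin(n,q) be independent random variables. Then P(X ≥ Y) ≥ 1/2. -/
/-- `binomPr n p k = C(n,k) p^k (1-p)^(n-k)`, the probability that a `Bin(n,p)` random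
variable takes the value `k`. -/
def binomPr (n : ℕ) (p : ℝ) (k : ℕ) : ℝ := (n.choose k : ℝ) * p ^ k * (1 - p) ^ (n - k)

lemma binomPr_nonneg (n : ℕ) (p : ℝ) (h0 : 0 ≤ p) (h1 : p ≤ 1) (k : ℕ) :
    0 ≤ binomPr n p k := by
  have : 0 ≤ 1 - p := by linarith
  unfold binomPr
  positivity

lemma binomPr_sum (n : ℕ) (p : ℝ) : ∑ k ∈ Finset.range (n + 1), binomPr n p k = 1 := by
  have h := add_pow p (1 - p) n
  rw [add_sub_cancel, one_pow] at h
  rw [h]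
  refine Finset.sum_congr rfl fun k _ => ?_
  unfold binomPr
  ring

/-- Monotone likelihood ratio. -/
lemma binomPr_mlr (n : ℕ) (p q : ℝ) (hp0 : 0 ≤ p) (hp1 : p ≤ 1)
    (hq0 : 0 ≤ q) (hq1 : q ≤ 1) (hpq : q ≤ p) (i j : ℕ) (hij : j ≤ i) (hi : i ≤ n) :
    binomPr n p j * binomPr n q i ≤ binomPr n p i * binomPr n q j := by
  obtain ⟨d, rfl⟩ := Nat.exists_eq_add_of_le hij
  obtain ⟨e, rfl⟩ := Nat.exists_eq_add_of_le hi
  have e1 : j + d + e - (j + d) = e := by omega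
  have e2 : j + d + e - j = d + e := by omega
  have hp : 0 ≤ 1 - p := by linarith
  have hq : 0 ≤ 1 - q := by linarith
  have key : (q * (1 - p)) ^ d ≤ (p * (1 - q)) ^ d := by
    apply pow_le_pow_left₀ (by positivity)
    nlinarith
  have hC : 0 ≤ ((j + d + e).choose j : ℝ) * ((j + d + e).choose (j + d) : ℝ) *
      (p ^ j * q ^ j * (1 - p) ^ e * (1 - q) ^ e) := by positivity
  have h := mul_le_mul_of_nonneg_left key hC
  unfold binomPr
  rw [e1, e2]
  simp only [mul_pow, pow_add] at h ⊢
  linarith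

/-- If `X ~ Bin(n,p)` and `Y ~ Bin(n,q)` are independent with `p ≥ q`,
then `P(X ≥ Y) ≥ 1/2`.  The probability `P(X ≥ Y)` is written out as the sum of the
joint (product) probabilities over all pairs of outcomes with `i ≥ j`. -/
theorem binomial_domination (n : ℕ) (p q : ℝ) (hp0 : 0 ≤ p) (hp1 : p ≤ 1)
    (hq0 : 0 ≤ q) (hq1 : q ≤ 1) (hpq : q ≤ p) :
    1 / 2 ≤ ∑ i ∈ Finset.range (n + 1), ∑ j ∈ Finset.range (n + 1),
      (if j ≤ i then binomPr n p i * binomPr n q j else 0) := by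
  have hT : ∑ i ∈ Finset.range (n + 1), ∑ j ∈ Finset.range (n + 1),
      (if i ≤ j then binomPr n p i * binomPr n q j else 0) ≤
      ∑ i ∈ Finset.range (n + 1), ∑ j ∈ Finset.range (n + 1),
      (if j ≤ i then binomPr n p i * binomPr n q j else 0) := by
    rw [Finset.sum_comm]
    refine Finset.sum_le_sum fun i hi => Finset.sum_le_sum fun j _ => ?_
    split_ifs with h
    · exact binomPr_mlr n p q hp0 hp1 hq0 hq1 hpq i j h
        (Nat.lt_succ_iff.mp (Finset.mem_range.mp hi))
    · exact le_rfl
  have h1 : (1 : ℝ) = ∑ i ∈ Finset.range (n + 1), ∑ j ∈ Finset.range (n + 1),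
      binomPr n p i * binomPr n q j := by
    rw [← Finset.sum_mul_sum, binomPr_sum, binomPr_sum, one_mul]
  have h2 : ∑ i ∈ Finset.range (n + 1), ∑ j ∈ Finset.range (n + 1),
      binomPr n p i * binomPr n q j ≤
      ∑ i ∈ Finset.range (n + 1), ∑ j ∈ Finset.range (n + 1),
      (if j ≤ i then binomPr n p i * binomPr n q j else 0) +
      ∑ i ∈ Finset.range (n + 1), ∑ j ∈ Finset.range (n + 1),
      (if i ≤ j then binomPr n p i * binomPr n q j else 0) := by
    rw [← Finset.sum_add_distrib]
    refine Finset.sum_le_sum fun i _ => ?_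
    rw [← Finset.sum_add_distrib]
    refine Finset.sum_le_sum fun j _ => ?_
    have := mul_nonneg (binomPr_nonneg n p hp0 hp1 i) (binomPr_nonneg n q hq0 hq1 j)
    split_ifs <;> first | linarith | omega
  linarith
end

section
/- Let a, b ∈ ℕ with a ≤ b, let A be the sum of a mutually independent ±1 uniform random variables and B the sum of b further such variables, all mutually independent. Then P(|A| < |B|) ≥ P(|A| > |B|). -/
/-- The position after `m` steps of a ±1 random walk, where the outcome of the `i`-th
step is encoded as a `Bool` (`true ↦ +1`, `false ↦ -1`). -/
def walk {m : ℕ} (ω : Fin m → Bool) : ℤ := ∑ i, (if ω i then 1 else -1)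

/-- The probability of an event `E` over `a + b` independent fair ±1 steps, the first `a`
of which form the walk `A` and the last `b` of which form the walk `B`. -/
noncomputable def walkPr (a b : ℕ)
    (E : (Fin a → Bool) × (Fin b → Bool) → Prop) [DecidablePred E] : ℝ :=
  ((Finset.univ.filter E).card : ℝ) / 2 ^ (a + b)

lemma sum_walk_succ (n : ℕ) (F : ℤ → ℤ) :
    ∑ ω : Fin (n + 1) → Bool, F (walk ω)
      = ∑ ω : Fin n → Bool, (F (walk ω + 1) + F (walk ω - 1)) := by
  rw [← (Fin.consEquiv (fun _ : Fin (n + 1) => Bool)).sum_comp, Fintype.sum_prod_type_right]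
  refine Finset.sum_congr rfl fun ω _ => ?_
  rw [Fintype.sum_bool]
  have h1 : walk ((Fin.consEquiv (fun _ : Fin (n + 1) => Bool)) (true, ω)) = walk ω + 1 := by
    simp [walk, Fin.consEquiv, Fin.sum_univ_succ]; ring
  have h2 : walk ((Fin.consEquiv (fun _ : Fin (n + 1) => Bool)) (false, ω)) = walk ω - 1 := by
    simp [walk, Fin.consEquiv, Fin.sum_univ_succ]; ring
  rw [h1, h2]

/-- Sums of products `f x * g y` with `f`, `g` odd and monotone. -/
inductive GoodFn : (ℤ → ℤ → ℤ) → Prop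
  | prod (f g : ℤ → ℤ) (hf : Monotone f) (hg : Monotone g)
      (hf' : ∀ x, f (-x) = - f x) (hg' : ∀ x, g (-x) = - g x) : GoodFn (fun x y => f x * g y)
  | add (h k : ℤ → ℤ → ℤ) : GoodFn h → GoodFn k → GoodFn (fun x y => h x y + k x y)

lemma GoodFn.diag {h : ℤ → ℤ → ℤ} (H : GoodFn h) (c : ℤ) : 0 ≤ h c c := by
  induction H with
  | prod f g hf hg hf' hg' =>
    have f0 := hf' 0
    have g0 := hg' 0
    simp only [neg_zero] at f0 g0
    rcases le_total 0 c with hc | hc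
    · have := hf hc
      have := hg hc
      exact mul_nonneg (by linarith) (by linarith)
    · have := hf hc
      have := hg hc
      exact mul_nonneg_of_nonpos_of_nonpos (by linarith) (by linarith)
  | add h k _ _ ih1 ih2 => exact add_nonneg ih1 ih2

lemma GoodFn.step {h : ℤ → ℤ → ℤ} (H : GoodFn h) :
    GoodFn (fun x y => h (x + 2) y + h (x - 2) y + h x (y + 2) + h x (y - 2)) := by
  induction H with
  | prod f g hf hg hf' hg' =>
    have key : ∀ f : ℤ → ℤ, Monotone f → (∀ x, f (-x) = - f x) →
        Monotone (fun x => f (x + 2) + f (x - 2)) ∧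
        ∀ x, (fun x => f (x + 2) + f (x - 2)) (-x) = - (fun x => f (x + 2) + f (x - 2)) x := by
      intro f hf hf'
      refine ⟨fun x y hxy => add_le_add (hf (by linarith)) (hf (by linarith)), fun x => ?_⟩
      have e1 := hf' (x - 2)
      have e2 := hf' (x + 2)
      rw [show -(x - 2) = -x + 2 by ring] at e1
      rw [show -(x + 2) = -x - 2 by ring] at e2
      simp only [e1, e2]
      ring
    obtain ⟨m1, o1⟩ := key f hf hf'
    obtain ⟨m2, o2⟩ := key g hg hg'
    convert GoodFn.add _ _ (GoodFn.prod _ g m1 hg o1 hg') (GoodFn.prod f _ hf m2 hf' o2) using 3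
    ring
  | add h k _ _ ih1 ih2 =>
    convert GoodFn.add _ _ ih1 ih2 using 3
    ring

lemma GoodFn.sum_nonneg (a : ℕ) : ∀ (b : ℕ) (_ : a ≤ b) (h : ℤ → ℤ → ℤ), GoodFn h →
    0 ≤ ∑ ω : Fin a → Bool, ∑ η : Fin b → Bool, h (walk ω + walk η) (walk η - walk ω) := by
  induction a with
  | zero =>
    intro b _ h H
    refine Finset.sum_nonneg fun ω _ => Finset.sum_nonneg fun η _ => ?_
    have : walk ω = 0 := by simp [walk]
    rw [this, zero_add, sub_zero]
    exact H.diag _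
  | succ a ih =>
    intro b hb h H
    obtain ⟨b, rfl⟩ : ∃ c, b = c + 1 := ⟨b - 1, by omega⟩
    have := ih b (by omega) _ H.step
    rw [sum_walk_succ a (fun x => ∑ η : Fin (b + 1) → Bool, h (x + walk η) (walk η - x))]
    refine this.trans_eq (Finset.sum_congr rfl fun ω _ => ?_)
    rw [sum_walk_succ b (fun y => h (walk ω + 1 + y) (y - (walk ω + 1))),
      sum_walk_succ b (fun y => h (walk ω - 1 + y) (y - (walk ω - 1))),
      ← Finset.sum_add_distrib]
    refine Finset.sum_congr rfl fun η _ => ?_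
    generalize walk ω = x
    generalize walk η = y
    rw [show x + 1 + (y + 1) = x + y + 2 by ring, show y + 1 - (x + 1) = y - x by ring,
      show x + 1 + (y - 1) = x + y by ring, show y - 1 - (x + 1) = y - x - 2 by ring,
      show x - 1 + (y + 1) = x + y by ring, show y + 1 - (x - 1) = y - x + 2 by ring,
      show x - 1 + (y - 1) = x + y - 2 by ring, show y - 1 - (x - 1) = y - x by ring]
    ring

lemma sign_mul_sign_eq (x y : ℤ) :
    Int.sign (x + y) * Int.sign (y - x)
      = (if |x| < |y| then 1 else 0) - (if |y| < |x| then 1 else 0) := by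
  rw [← Int.sign_mul, show (x + y) * (y - x) = y ^ 2 - x ^ 2 by ring]
  rcases lt_trichotomy |x| |y| with h | h | h
  · rw [if_pos h, if_neg h.not_gt, Int.sign_eq_one_of_pos (sub_pos.2 (sq_lt_sq.2 h))]; rfl
  · rw [(sq_eq_sq_iff_abs_eq_abs x y).2 h, h]; simp
  · rw [if_pos h, if_neg h.not_gt, Int.sign_eq_neg_one_of_neg (sub_neg.2 (sq_lt_sq.2 h))]; rfl

lemma sign_monotone : Monotone Int.sign := by
  intro x y hxy
  rcases lt_trichotomy x 0 with h | h | h <;> rcases lt_trichotomy y 0 with h' | h' | h' <;>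
    first
    | omega
    | simp [Int.sign_eq_one_of_pos, Int.sign_eq_neg_one_of_neg, h, h']

/-- For `a ≤ b`, where `A` is the sum of `a` independent uniform ±1
random variables and `B` the sum of `b` further such variables (all mutually
independent), it holds that `P(|A| < |B|) ≥ P(|A| > |B|)`. -/
theorem walk_abs_lt_ge_abs_gt (a b : ℕ) (hab : a ≤ b) :
    walkPr a b (fun ω => |walk ω.2| < |walk ω.1|) ≤
      walkPr a b (fun ω => |walk ω.1| < |walk ω.2|) := by
  have H := GoodFn.sum_nonneg a b hab _
    (GoodFn.prod Int.sign Int.sign sign_monotone sign_monotone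
      (fun x => Int.sign_neg x) (fun x => Int.sign_neg x))
  simp only [sign_mul_sign_eq] at H
  rw [← Fintype.sum_prod_type' (f := fun (ω : Fin a → Bool) (η : Fin b → Bool) =>
    (if |walk ω| < |walk η| then (1 : ℤ) else 0) - (if |walk η| < |walk ω| then 1 else 0)),
    Finset.sum_sub_distrib, Finset.sum_boole, Finset.sum_boole] at H
  unfold walkPr
  refine div_le_div_of_nonneg_right ?_ (by positivity)
  have := sub_nonneg.1 H
  exact_mod_cast this
end

section
/- Let a, b ∈ ℕ with a ≤ b, let A be the sum of a mutually independent ±1 uniform random variables and B the sum of b further such variables, all mutually independent. Then for every integer k ≥ 0, it holds that P(|B| − |A| = k) ≥ P(|B| − |A| = −k). -/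
/-- Sum of `f` over the endpoints of all `n`-step walks. -/
def walkT (n : ℕ) (f : ℤ → ℤ) : ℤ := ∑ ω : Fin n → Bool, f (walk ω)

lemma walkT_zero (f : ℤ → ℤ) : walkT 0 f = f 0 := by
  simp [walkT, walk]

lemma walkT_succ (n : ℕ) (f : ℤ → ℤ) :
    walkT (n + 1) f = walkT n (fun x => f (x + 1) + f (x - 1)) := by
  unfold walkT
  rw [← (Fin.consEquiv (fun _ : Fin (n + 1) => Bool)).sum_comp, Fintype.sum_prod_type,
    Fintype.sum_bool, ← Finset.sum_add_distrib]
  refine Finset.sum_congr rfl fun ω _ => ?_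
  simp [walk, Fin.consEquiv, Fin.sum_univ_succ]
  congr 2 <;> ring

lemma walkT_add (n : ℕ) (f g : ℤ → ℤ) :
    walkT n (fun x => f x + g x) = walkT n f + walkT n g := by
  simp [walkT, Finset.sum_add_distrib]

lemma walkT_mono (n : ℕ) {f g : ℤ → ℤ} (h : ∀ x, f x ≤ g x) : walkT n f ≤ walkT n g :=
  Finset.sum_le_sum fun _ _ => h _

/-- Number of walks ending at `x`. -/
def walkW (n : ℕ) (x : ℤ) : ℤ := walkT n (fun y => if y = x then 1 else 0)

lemma walkW_succ (n : ℕ) (x : ℤ) :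
    walkW (n + 1) x = walkW n (x - 1) + walkW n (x + 1) := by
  unfold walkW
  rw [walkT_succ, walkT_add]
  congr 2 <;> funext y <;> congr 1 <;> apply propext <;> omega

lemma walkW_neg (n : ℕ) : ∀ x : ℤ, walkW n (-x) = walkW n x := by
  induction n with
  | zero => intro x; simp [walkW, walkT_zero, eq_comm]
  | succ n ih =>
    intro x
    rw [walkW_succ, walkW_succ, ← ih (x - 1), ← ih (x + 1), add_comm]
    congr 2 <;> ring

lemma walkW_abs (n : ℕ) (x : ℤ) : walkW n |x| = walkW n x := by
  rcases abs_choice x with h | h <;> rw [h]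
  exact walkW_neg n x

lemma walkW_anti (n : ℕ) : ∀ x y : ℤ, |x| ≤ |y| → (2 : ℤ) ∣ y - x → walkW n y ≤ walkW n x := by
  induction n with
  | zero =>
    intro x y h _
    simp only [walkW, walkT_zero]
    grind
  | succ n ih =>
    have key : ∀ x y : ℤ, 0 ≤ x → x ≤ y → (2 : ℤ) ∣ y - x →
        walkW (n + 1) y ≤ walkW (n + 1) x := by
      intro x y hx hxy hd
      rcases hxy.eq_or_lt with rfl | hlt
      · rfl
      rw [walkW_succ, walkW_succ]
      have h1 := ih (x + 1) (y - 1) (by grind) (by omega)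
      have h2 := ih (x - 1) (y + 1) (by grind) (by omega)
      linarith
    intro x y h hd
    rw [← walkW_abs _ x, ← walkW_abs _ y]
    exact key _ _ (abs_nonneg _) h (by grind)

/-- Number of pairs of walks with `|B| - |A| = k`. -/
def walkN (k : ℤ) (a b : ℕ) : ℤ :=
  walkT a (fun x => walkT b (fun y => if |y| - |x| = k then 1 else 0))

lemma walkN_step (k : ℤ) (hk : 0 < k) (a b : ℕ) : walkN k (a + 1) b ≤ walkN k a (b + 1) := by
  unfold walkN
  rw [walkT_succ]
  apply walkT_mono
  intro x
  rw [walkT_succ, ← walkT_add]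
  by_cases hx : x = 0
  · subst hx
    have h1 : (fun y : ℤ => (if |y| - |(0:ℤ) + 1| = k then (1:ℤ) else 0) +
        (if |y| - |(0:ℤ) - 1| = k then 1 else 0)) =
        fun y => ((if y = k + 1 then 1 else 0) + (if y = -(k + 1) then 1 else 0)) +
          ((if y = k + 1 then 1 else 0) + (if y = -(k + 1) then 1 else 0)) := by
      funext y
      norm_num
      grind
    have h2 : (fun y : ℤ => (if |y + 1| - |(0:ℤ)| = k then (1:ℤ) else 0) +
        (if |y - 1| - |(0:ℤ)| = k then 1 else 0)) =
        fun y => ((if y = k - 1 then 1 else 0) + (if y = -(k + 1) then 1 else 0)) +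
          ((if y = k + 1 then 1 else 0) + (if y = -(k - 1) then 1 else 0)) := by
      funext y
      norm_num
      grind
    rw [h1, h2]
    simp only [walkT_add]
    change (walkW b (k + 1) + walkW b (-(k + 1))) + (walkW b (k + 1) + walkW b (-(k + 1))) ≤
      (walkW b (k - 1) + walkW b (-(k + 1))) + (walkW b (k + 1) + walkW b (-(k - 1)))
    rw [walkW_neg, walkW_neg]
    have := walkW_anti b (k - 1) (k + 1) (by grind) (by omega)
    linarith
  · apply walkT_mono
    intro y
    grind

lemma walkN_anti (k : ℤ) (hk : 0 < k) (a d c : ℕ) : walkN k (a + d) c ≤ walkN k a (c + d) := by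
  induction d generalizing c with
  | zero => exact le_rfl
  | succ d ih =>
    have h1 := walkN_step k hk (a + d) c
    have h2 := ih (c + 1)
    rw [show c + (d + 1) = c + 1 + d by ring]
    exact h1.trans h2

lemma walkN_card (k : ℤ) (a b : ℕ) :
    ((Finset.univ.filter (fun ω : (Fin a → Bool) × (Fin b → Bool) =>
      |walk ω.2| - |walk ω.1| = k)).card : ℤ) = walkN k a b := by
  rw [Finset.card_filter]
  push_cast
  rw [Fintype.sum_prod_type]
  rfl

lemma walkN_swap (k : ℤ) (a b : ℕ) : walkN (-k) a b = walkN k b a := by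
  unfold walkN walkT
  rw [Finset.sum_comm]
  refine Finset.sum_congr rfl fun x _ => Finset.sum_congr rfl fun y _ => ?_
  beta_reduce
  congr 1
  apply propext
  omega

/-- For `a ≤ b`, where `A` is the sum of `a` independent uniform ±1
random variables and `B` the sum of `b` further such variables (all mutually
independent), for every integer `k ≥ 0` it holds that
`P(|B| − |A| = k) ≥ P(|B| − |A| = −k)`. -/
theorem walk_abs_diff_symm (a b : ℕ) (hab : a ≤ b) (k : ℤ) (hk : 0 ≤ k) :
    walkPr a b (fun ω => |walk ω.2| - |walk ω.1| = -k) ≤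
      walkPr a b (fun ω => |walk ω.2| - |walk ω.1| = k) := by
  rcases hk.eq_or_lt with rfl | hk
  · simp
  obtain ⟨d, rfl⟩ := Nat.exists_eq_add_of_le hab
  have h := walkN_anti k hk a d a
  rw [← walkN_swap, ← walkN_card, ← walkN_card] at h
  unfold walkPr
  apply div_le_div_of_nonneg_right _ (by positivity)
  exact_mod_cast h
end

section
/- Let a, b ∈ ℕ with a ≤ b, let A be the sum of a mutually independent ±1 uniform random variables and B the sum of b further such variables, all mutually independent. If a = b = 0 or a = b = 1, then P(|A| < |B|) = 0. In every other case, P(|A| < |B|) ≥ 3/16. -/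
/-- Sum of `f` over the endpoints of all `±1` walks with `m` steps. -/
def wsum : ℕ → (ℤ → ℤ) → ℤ
  | 0, f => f 0
  | m + 1, f => wsum m (fun x => f (1 + x)) + wsum m (fun x => f (-1 + x))

lemma sum_walk_eq (m : ℕ) (f : ℤ → ℤ) : ∑ ω : Fin m → Bool, f (walk ω) = wsum m f := by
  induction m generalizing f with
  | zero => simp [wsum, walk]
  | succ m ih =>
    rw [← (Fin.consEquiv (fun _ : Fin (m + 1) => Bool)).sum_comp, Fintype.sum_prod_type]
    simp [wsum, ← ih, walk, Fin.consEquiv, Fin.sum_univ_succ]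

lemma wsum_add (m : ℕ) (f g : ℤ → ℤ) : wsum m (fun x => f x + g x) = wsum m f + wsum m g := by
  simp only [← sum_walk_eq, Finset.sum_add_distrib]

lemma wsum_sub (m : ℕ) (f g : ℤ → ℤ) : wsum m (fun x => f x - g x) = wsum m f - wsum m g := by
  simp only [← sum_walk_eq, Finset.sum_sub_distrib]

lemma wsum_mono (m : ℕ) (f g : ℤ → ℤ) (h : ∀ x, f x ≤ g x) : wsum m f ≤ wsum m g := by
  simp only [← sum_walk_eq]
  exact Finset.sum_le_sum fun _ _ => h _

lemma wsum_const (m : ℕ) (c : ℤ) : wsum m (fun _ => c) = 2 ^ m * c := by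
  simp [← sum_walk_eq]

lemma wsum_neg (m : ℕ) (f : ℤ → ℤ) : wsum m (fun x => f (-x)) = wsum m f := by
  induction m generalizing f with
  | zero => simp [wsum]
  | succ m ih =>
    simp only [wsum]
    rw [← ih (fun x => f (1 + x)), ← ih (fun x => f (-1 + x)), add_comm]
    congr 2 <;> · funext x; congr 1; ring

lemma wsum_comp (m n : ℕ) (f : ℤ → ℤ) :
    wsum m (fun x => wsum n (fun y => f (x + y))) = wsum (m + n) f := by
  induction m generalizing f with
  | zero => simp [wsum]
  | succ m ih =>
    rw [Nat.succ_add]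
    simp only [wsum]
    rw [← ih, ← ih]
    simp only [add_assoc]

lemma wsum_comm (m n : ℕ) (f : ℤ → ℤ → ℤ) :
    wsum m (fun x => wsum n (fun y => f x y)) = wsum n (fun y => wsum m (fun x => f x y)) := by
  simp only [← sum_walk_eq]
  exact Finset.sum_comm

/-- The paired correlation of signs. -/
def corr (a : ℕ) (x y : ℤ) : ℤ :=
  wsum a (fun s => wsum a (fun t => Int.sign (x + s + t) * Int.sign (y + t - s)))

lemma corr_succ (a : ℕ) (x y : ℤ) :
    corr (a + 1) x y = corr a (x + 2) y + corr a x (y - 2) + (corr a x (y + 2) + corr a (x - 2) y) := by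
  simp only [corr, wsum, wsum_add]
  congr 2 <;> congr 1 <;> funext s <;> congr 1 <;> funext t <;> ring_nf

lemma corr_props (a : ℕ) :
    (∀ x y, corr a (-x) y = - corr a x y) ∧ (∀ x y, corr a x (-y) = - corr a x y) ∧
    (∀ x x' y y', x ≤ x' → y ≤ y' → 0 ≤ corr a x' y' - corr a x y' - corr a x' y + corr a x y) := by
  induction a with
  | zero =>
    have hm : ∀ x x' : ℤ, x ≤ x' → x.sign ≤ x'.sign := by
      intro x x' h
      rcases lt_trichotomy x 0 with h1 | h1 | h1 <;> rcases lt_trichotomy x' 0 with h2 | h2 | h2 <;>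
        simp [h1, h2, Int.sign_eq_one_of_pos, Int.sign_eq_neg_one_of_neg] <;> omega
    refine ⟨?_, ?_, ?_⟩
    · intro x y; simp [corr, wsum, Int.sign_neg]
    · intro x y; simp [corr, wsum, Int.sign_neg]
    · intro x x' y y' h1 h2
      simp only [corr, wsum, add_zero, sub_zero]
      nlinarith [mul_nonneg (sub_nonneg.2 (hm x x' h1)) (sub_nonneg.2 (hm y y' h2))]
  | succ a ih =>
    obtain ⟨h1, h2, h3⟩ := ih
    refine ⟨?_, ?_, ?_⟩
    · intro x y
      simp only [corr_succ]
      rw [show -x + 2 = -(x - 2) by ring, show -x - 2 = -(x + 2) by ring]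
      simp only [h1]; ring
    · intro x y
      simp only [corr_succ]
      rw [show -y + 2 = -(y - 2) by ring, show -y - 2 = -(y + 2) by ring]
      simp only [h2]; ring
    · intro x x' y y' hx hy
      simp only [corr_succ]
      linarith [h3 (x + 2) (x' + 2) y y' (by omega) hy, h3 (x - 2) (x' - 2) y y' (by omega) hy,
        h3 x x' (y + 2) (y' + 2) hx (by omega), h3 x x' (y - 2) (y' - 2) hx (by omega)]

lemma corr_diag_nonneg (a : ℕ) (x : ℤ) : 0 ≤ corr a x x := by
  obtain ⟨h1, h2, h3⟩ := corr_props a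
  have z1 : ∀ y, corr a 0 y = 0 := fun y => by have := h1 0 y; simp at this; omega
  have z2 : ∀ y, corr a y 0 = 0 := fun y => by have := h2 y 0; simp at this; omega
  rcases le_total 0 x with h | h
  · have := h3 0 x 0 x h h
    simp [z1, z2] at this; exact this
  · have := h3 x 0 x 0 h h
    simp [z1, z2] at this; exact this

lemma sign_sum_nonneg (a c : ℕ) :
    0 ≤ wsum a (fun s => wsum (a + c) (fun t => Int.sign (t + s) * Int.sign (t - s))) := by
  have h : wsum a (fun s => wsum (a + c) (fun t => Int.sign (t + s) * Int.sign (t - s)))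
      = wsum c (fun x => corr a x x) := by
    simp only [corr]
    rw [wsum_comm c a]
    congr 1; funext s
    rw [add_comm a c, ← wsum_comp c a]
    congr 1; funext x; congr 1; funext t; ring_nf
  rw [h]
  have := wsum_mono c (fun _ => 0) _ (fun x => corr_diag_nonneg a x)
  simpa [wsum_const] using this

lemma atom_bound (n : ℕ) (x : ℤ) :
    16 * wsum (n + 5) (fun y => if y = x then 1 else 0) ≤ 5 * 2 ^ (n + 5) := by
  induction n generalizing x with
  | zero =>
    by_cases h : -5 ≤ x ∧ x ≤ 5
    · obtain ⟨h1, h2⟩ := h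
      interval_cases x <;> decide
    · simp only [wsum]
      have : ∀ y : ℤ, -5 ≤ y → y ≤ 5 → (if y = x then (1 : ℤ) else 0) = 0 := by
        intro y _ _; rw [if_neg]; omega
      norm_num [this]
  | succ n ih =>
    rw [show n + 1 + 5 = (n + 5) + 1 by ring, wsum]
    have e1 : ∀ y : ℤ, (1 + y = x) = (y = x - 1) := fun y => by apply propext; omega
    have e2 : ∀ y : ℤ, (-1 + y = x) = (y = x + 1) := fun y => by apply propext; omega
    simp only [e1, e2]
    have := ih (x - 1)
    have := ih (x + 1)
    rw [pow_succ]; linarith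

/-- Number of outcomes with `|A| < |B|`. -/
def cnt (a b : ℕ) : ℤ := wsum a (fun s => wsum b (fun t => if |s| < |t| then 1 else 0))

lemma cnt_eq (a b : ℕ) : walkPr a b (fun ω => |walk ω.1| < |walk ω.2|) = (cnt a b : ℝ) / 2 ^ (a + b) := by
  unfold walkPr
  congr 1
  have : ((Finset.univ.filter (fun ω : (Fin a → Bool) × (Fin b → Bool) =>
      |walk ω.1| < |walk ω.2|)).card : ℤ) = cnt a b := by
    rw [Finset.card_filter]
    push_cast
    rw [Fintype.sum_prod_type, cnt, ← sum_walk_eq]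
    refine Finset.sum_congr rfl fun ω _ => ?_
    rw [← sum_walk_eq]
  rw [← this]; simp

lemma sign_pt (s t : ℤ) : 1 + Int.sign (t + s) * Int.sign (t - s) ≤
    2 * (if |s| < |t| then 1 else 0) + ((if s + t = 0 then 1 else 0) + (if -s + t = 0 then 1 else 0)) := by
  have key : |s| < |t| ↔ 0 < (t + s) * (t - s) := by
    rw [← sq_lt_sq]; constructor <;> intro h <;> nlinarith
  simp only [key, ← Int.sign_mul]
  rcases lt_trichotomy ((t + s) * (t - s)) 0 with h | h | h
  · rw [Int.sign_eq_neg_one_of_neg h]; split_ifs <;> omega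
  · rw [h]
    rcases mul_eq_zero.1 h with h | h
    · rw [if_pos (show s + t = 0 by omega)]; split_ifs <;> simp
    · rw [if_pos (show -s + t = 0 by omega)]; split_ifs <;> simp
  · rw [Int.sign_eq_one_of_pos h, if_pos h]; split_ifs <;> omega

lemma cnt_large (a c : ℕ) (h : 5 ≤ a + (a + c)) : 3 * 2 ^ (a + (a + c)) ≤ 16 * cnt a (a + c) := by
  have h1 := sign_sum_nonneg a c
  obtain ⟨n, hn⟩ := Nat.exists_eq_add_of_le' h
  have h2 := atom_bound n 0
  rw [← hn] at h2
  have h3 := wsum_comp a (a + c) (fun y => if y = 0 then 1 else 0)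
  have h4 := wsum_neg a (fun s => wsum (a + c) (fun t => if s + t = 0 then 1 else 0))
  have h5 := wsum_mono a _ _ (fun s => wsum_mono (a + c) _ _ (fun t => sign_pt s t))
  simp only [wsum_add, two_mul, wsum_const] at h5
  simp only [cnt]
  simp only [pow_add] at h2 h5 ⊢
  linarith

/-- For `a ≤ b`, where `A` is the sum of `a` independent uniform ±1
random variables and `B` the sum of `b` further such variables (all mutually
independent): if `a = b = 0` or `a = b = 1` then `P(|A| < |B|) = 0`; in every other case
`P(|A| < |B|) ≥ 3/16`. -/
theorem walk_abs_lt_three_sixteenth (a b : ℕ) (hab : a ≤ b) :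
    ((a = 0 ∧ b = 0) ∨ (a = 1 ∧ b = 1) →
      walkPr a b (fun ω => |walk ω.1| < |walk ω.2|) = 0) ∧
    (¬((a = 0 ∧ b = 0) ∨ (a = 1 ∧ b = 1)) →
      3 / 16 ≤ walkPr a b (fun ω => |walk ω.1| < |walk ω.2|)) := by
  rw [cnt_eq]
  constructor
  · rintro (⟨rfl, rfl⟩ | ⟨rfl, rfl⟩)
    · rw [show cnt 0 0 = 0 by decide]; simp
    · rw [show cnt 1 1 = 0 by decide]; simp
  · intro hne
    have key : 3 * 2 ^ (a + b) ≤ 16 * cnt a b := by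
      by_cases h : 5 ≤ a + b
      · obtain ⟨c, rfl⟩ := Nat.exists_eq_add_of_le hab
        exact cnt_large a c h
      · have ha : a ≤ 2 := by omega
        have hb : b ≤ 4 := by omega
        interval_cases a <;> interval_cases b <;> first | omega | decide
    have key' : (3 : ℝ) * 2 ^ (a + b) ≤ 16 * cnt a b := by exact_mod_cast key
    rw [div_le_div_iff₀ (by norm_num) (by positivity)]
    linarith
end

section
/- Let n, d ∈ ℕ with 1 ≤ d < n, and let p ∈ [0,1]. Then C(n,d) · p^d · (1−p)^(n−d) ≤ 1/(√(2πd)) · (1 − d/n)^(−d). -/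
/-- For `1 ≤ d < n` and `p ∈ [0,1]`,
`C(n,d) · p^d · (1−p)^(n−d) ≤ 1/√(2πd) · (1 − d/n)^(−d)`. -/
theorem binomial_term_bound (n d : ℕ) (hd1 : 1 ≤ d) (hdn : d < n) (p : ℝ)
    (hp0 : 0 ≤ p) (hp1 : p ≤ 1) :
    (n.choose d : ℝ) * p ^ d * (1 - p) ^ (n - d) ≤
      1 / Real.sqrt (2 * Real.pi * d) * (1 - (d : ℝ) / n) ^ (-(d : ℤ)) := by
  obtain ⟨m, rfl⟩ : ∃ m, n = d + m := ⟨n - d, by omega⟩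
  have hm : 0 < m := by omega
  have hD : (0 : ℝ) < d := by exact_mod_cast hd1
  have hM : (0 : ℝ) < m := by exact_mod_cast hm
  have hN : (0 : ℝ) < ((d + m : ℕ) : ℝ) := by exact_mod_cast (by omega)
  have hNe : ((d + m : ℕ) : ℝ) = d + m := by push_cast; ring
  rw [Nat.add_sub_cancel_left]
  have hp1' : 0 ≤ 1 - p := by linarith
  set N : ℝ := ((d + m : ℕ) : ℝ) with hNdef
  set r : ℝ := 1 - (d : ℝ) / N with hr
  have hrm : r = m / N := by
    rw [hr]; field_simp; linarith
  have hr0 : 0 < r := by rw [hrm]; positivity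
  set S := Real.sqrt (2 * Real.pi * d) with hS
  have hS0 : 0 < S := by rw [hS]; have := Real.pi_pos; positivity
  have hst : S * (d / Real.exp 1) ^ d ≤ (d.factorial : ℝ) := Stirling.le_factorial_stirling d
  have hch : ((d + m).choose d : ℝ) ≤ N ^ d / d.factorial := Nat.choose_le_pow_div d (d + m)
  have hch2 : ((d + m).choose d : ℝ) ≤ N ^ d / (S * (d / Real.exp 1) ^ d) := by
    refine hch.trans ?_
    gcongr
  have hA : (p * N / d * Real.exp 1) ^ d ≤ Real.exp (p * N) := by
    have h : p * N / d * Real.exp 1 ≤ Real.exp (p * N / d) := by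
      have h1 := Real.add_one_le_exp (p * N / d - 1)
      have h2 : Real.exp (p * N / d) = Real.exp (p * N / d - 1) * Real.exp 1 := by
        rw [← Real.exp_add]; congr 1; ring
      rw [h2]; gcongr; linarith
    calc _ ≤ Real.exp (p * N / d) ^ d := by gcongr
      _ = _ := by rw [← Real.exp_nat_mul]; congr 1; field_simp
  have hB : ((1 - p) / r) ^ m ≤ Real.exp (d - p * N) := by
    have h : (1 - p) / r ≤ Real.exp ((1 - p) / r - 1) := by
      have h1 := Real.add_one_le_exp ((1 - p) / r - 1)
      linarith
    calc _ ≤ Real.exp ((1 - p) / r - 1) ^ m := by gcongr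
      _ = _ := by
        rw [← Real.exp_nat_mul]; congr 1; rw [hrm]; field_simp; rw [hNe]; ring
  have hC : r ^ (d + m) ≤ Real.exp (-d) := by
    have h : r ≤ Real.exp (-(d / N)) := by
      have h1 := Real.add_one_le_exp (-((d : ℝ) / N))
      rw [hr]; linarith
    calc _ ≤ Real.exp (-(d / N)) ^ (d + m) := by gcongr
      _ = _ := by
        rw [← Real.exp_nat_mul, ← hNdef]; congr 1; field_simp
  have key : (p * N / d * Real.exp 1) ^ d * ((1 - p) / r) ^ m * r ^ (d + m) ≤ 1 := by
    calc _ ≤ Real.exp (p * N) * Real.exp (d - p * N) * Real.exp (-d) := by gcongr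
      _ = 1 := by rw [← Real.exp_add, ← Real.exp_add]; simp
  rw [zpow_neg, zpow_natCast]
  calc _ ≤ N ^ d / (S * (d / Real.exp 1) ^ d) * p ^ d * (1 - p) ^ m := by gcongr
    _ = 1 / S * (r ^ d)⁻¹ * ((p * N / d * Real.exp 1) ^ d * ((1 - p) / r) ^ m * r ^ (d + m)) := by
      have := Real.exp_pos 1
      simp only [div_pow, mul_pow, pow_add]
      field_simp
    _ ≤ 1 / S * (r ^ d)⁻¹ * 1 := by gcongr
    _ = _ := by ring
end

section
/- For every real number τ with 0 ≤ τ ≤ 4/5, it holds that 2·arccos(τ/2) − sin(2·arccos(τ/2)) ≥ π/2. -/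
/-- For every real `τ` with `0 ≤ τ ≤ 4/5`, it holds that
`2·arccos(τ/2) − sin(2·arccos(τ/2)) ≥ π/2`. -/
theorem arccos_lens_bound (τ : ℝ) (hτ0 : 0 ≤ τ) (hτ : τ ≤ 4 / 5) :
    Real.pi / 2 ≤ 2 * Real.arccos (τ / 2) - Real.sin (2 * Real.arccos (τ / 2)) := by
  have hpi := Real.pi_gt_d2
  have hb : Real.arcsin (τ / 2) ≤ 0.4134 := by
    rw [Real.arcsin_le_iff_le_sin ⟨by linarith, by linarith⟩ ⟨by linarith, by linarith⟩]
    have h := Real.sin_bound (x := 0.4134) (by rw [abs_of_pos] <;> norm_num)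
    have h2 := (abs_le.1 h).1
    rw [abs_of_pos (by norm_num : (0:ℝ) < 0.4134)] at h2
    norm_num at h2 ⊢
    linarith
  have hc : Real.cos (Real.arccos (τ / 2)) = τ / 2 :=
    Real.cos_arccos (by linarith) (by linarith)
  have hsq := Real.sin_sq_add_cos_sq (Real.arccos (τ / 2))
  have ha : Real.arccos (τ / 2) = Real.pi / 2 - Real.arcsin (τ / 2) := rfl
  rw [Real.sin_two_mul]
  rw [hc] at hsq ⊢
  have hs : 2 * Real.sin (Real.arccos (τ / 2)) * (τ / 2) ≤ 0.734 := by
    nlinarith [sq_nonneg (2.29 * (τ / 2) - Real.sin (Real.arccos (τ / 2)))]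
  linarith
end
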